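/- Consider the supervision game restricted to the human type whose model deems π_pr unsafe, and assume C_P^R(π_pr) + C_E^R(π_pr) < C_P^R(π_s) + C_E^R(π_s) < C_P^R(π_pr) + C_G̃ and C_P^H(π_s) > 0. Then there exists q_N with 0 < q_N < 1 such that under the human mixed strategy (1−q_N, 0, q_N) over (O_P, O_E, NO): (a) the robot's expected utility from π_s strictly exceeds its expected utility from π_pr, and (b) the human's expected utility when the robot plays π_s, namely −(1−q_N)·C_P^H(π_s), strictly exceeds the human's utility −C_P^H(π_s) from the pure plan-observation strategy (1, 0, 0). -/

import Mathlib

/-- For the human type deeming π_pr unsafe, assuming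
C_P^R(π_pr)+C_E^R(π_pr) < C_P^R(π_s)+C_E^R(π_s) < C_P^R(π_pr)+C_G̃ and
C_P^H(π_s) > 0, there is q_N ∈ (0,1) such that under (1−q_N, 0, q_N):
(a) the robot strictly prefers π_s to π_pr in expectation, and (b) the human's
expected utility −(1−q_N)·C_P^H(π_s) when the robot plays π_s strictly exceeds
−C_P^H(π_s), the utility of always observing the plan. -/
theorem stmt_9
    (CPRpr CPRs CERpr CERs CERhat CG CPHs : ℝ)
    (hCPRpr : 0 ≤ CPRpr) (hCPRs : 0 ≤ CPRs) (hCERpr : 0 ≤ CERpr)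
    (hCERs : 0 ≤ CERs) (hCERhat : 0 ≤ CERhat) (hCG : 0 ≤ CG)
    (h1 : CPRpr + CERpr < CPRs + CERs)
    (h2 : CPRs + CERs < CPRpr + CG)
    (hCPHs : 0 < CPHs) :
    ∃ qN : ℝ, 0 < qN ∧ qN < 1 ∧
      (((1 - 0 - qN) * (-CPRpr - CG) + 0 * (-CPRpr - CERhat - CG) +
          qN * (-CPRpr - CERpr)) <
        ((1 - 0 - qN) * (-CPRs - CERs) + 0 * (-CPRs - CERs) +
          qN * (-CPRs - CERs))) ∧
      -CPHs < -(1 - qN) * CPHs := by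
  have hD : 0 < 2 * (CG - CERpr) := by linarith
  have ha : 0 < CPRpr + CG - (CPRs + CERs) := by linarith
  obtain ⟨q, hq⟩ : ∃ q : ℝ, q = (CPRpr + CG - (CPRs + CERs)) / (2 * (CG - CERpr)) := ⟨_, rfl⟩
  have hq0 : 0 < q := by rw [hq]; exact div_pos ha hD
  have hq1 : q < 1 := by rw [hq, div_lt_one hD]; linarith
  have hm : q * (2 * (CG - CERpr)) = CPRpr + CG - (CPRs + CERs) := by
    rw [hq]; exact div_mul_cancel₀ _ hD.ne'
  have hp : 0 < q * CPHs := mul_pos hq0 hCPHs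
  refine ⟨q, hq0, hq1, ?_, ?_⟩
  · linarith
  · linarith
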